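/- Let N ≥ 1, let A be a symmetric positive-definite N×N matrix with rational entries, B ∈ ℚ^N, and set Q(n) = (1/2)nᵀAn + Bᵀn for n ∈ ℤ^N. Let d be a positive integer with d·Q(k) ∈ ℤ for all k ∈ ℤ^N, let m be an odd positive integer with gcd(m, 2d) = 1, let a ∈ ℤ with gcd(a, m) = 1, and put ζ = e^{2πia/m}. Let z ∈ (0,1)^N satisfy Nahm's equation 1 − z_i = ∏_j z_j^{A_{ij}}, and set θ_i = z_i^{1/m} (positive real root). For each k ∈ {0,…,m−1}^N choose r_k ∈ ℤ with d·r_k ≡ d·Q(k) (mod m). Define S = ( ∏_{i=1}^N exp( −(1/m) ∑_{t=1}^{m−1} t·Log(1 − ζ^{t+1} θ_i) ) ) · ∑_{k ∈ {0,…,m−1}^N} exp(2πi·a·r_k/m) · ∏_{i=1}^N θ_i^{(Ak)_i} / ∏_{j=1}^{k_i} (1 − ζ^j θ_i). Then S^m lies in the subfield of ℂ generated by ζ and the positive real numbers z_1^{1/d}, …, z_N^{1/d}. -/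

import Mathlib

open Complex Matrix

/-- The finite `q`-Pochhammer symbol `(ζx; ζ)_n`. -/
def qPoch {L : Type*} [Field L] (ζ x : L) (n : ℕ) : L :=
  ∏ j ∈ Finset.range n, (1 - ζ ^ (j + 1) * x)

/-- The cyclic quantum dilogarithm `D_ζ(ζx)` of order `m`. -/
def cyclicDilog {L : Type*} [Field L] (ζ : L) (m : ℕ) (x : L) : L :=
  ∏ t ∈ Finset.range m, (1 - ζ ^ (t + 1) * x) ^ t

lemma qPoch_add {L : Type*} [Field L] (ζ x : L) (n s : ℕ) :
    qPoch ζ x (n + s) = qPoch ζ (ζ ^ s * x) n * qPoch ζ x s := by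
  unfold qPoch
  rw [add_comm n s, Finset.prod_range_add, mul_comm]
  congr 1
  refine Finset.prod_congr rfl fun j _ => ?_
  ring

lemma qPoch_order {L : Type*} [Field L] {ζ : L} {m : ℕ} (hm : 0 < m)
    (hζ : IsPrimitiveRoot ζ m) (x : L) : qPoch ζ x m = 1 - x ^ m := by
  have h := hζ.pow_sub_pow_eq_prod_sub_mul 1 x hm
  rw [one_pow] at h
  rw [h]
  unfold qPoch
  refine Finset.prod_bij (fun j _ => ζ ^ (j + 1)) ?_ ?_ ?_ ?_
  · intro j _
    rw [Polynomial.mem_nthRootsFinset hm, ← pow_mul, mul_comm, pow_mul, hζ.pow_eq_one, one_pow]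
  · intro i hi j hj hij
    have hz : ζ ≠ 0 := hζ.ne_zero hm.ne'
    rw [pow_succ, pow_succ] at hij
    exact hζ.pow_inj (Finset.mem_range.1 hi) (Finset.mem_range.1 hj) (mul_right_cancel₀ hz hij)
  · intro y hy
    rw [Polynomial.mem_nthRootsFinset hm] at hy
    have hz : ζ ≠ 0 := hζ.ne_zero hm.ne'
    have : NeZero m := ⟨hm.ne'⟩
    obtain ⟨i, hi, h⟩ := hζ.eq_pow_of_pow_eq_one (ξ := y * ζ⁻¹)
      (by rw [mul_pow, hy, inv_pow, hζ.pow_eq_one]; simp)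
    exact ⟨i, Finset.mem_range.2 hi, by rw [pow_succ, h]; field_simp⟩
  · intro j _
    rfl

lemma qPoch_order_mul {L : Type*} [Field L] {ζ : L} {m : ℕ} (hm : 0 < m)
    (hζ : IsPrimitiveRoot ζ m) (x : L) (l : ℕ) : qPoch ζ x (m * l) = (1 - x ^ m) ^ l := by
  induction l with
  | zero => simp [qPoch]
  | succ l ih =>
    rw [Nat.mul_succ, add_comm, qPoch_add, ih, qPoch_order hm hζ, pow_mul, hζ.pow_eq_one, one_pow,
      one_mul, pow_succ']

lemma qPoch_ne_zero {L : Type*} [Field L] {ζ x : L} {m : ℕ} (hζ : ζ ^ m = 1)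
    (hx : 1 - x ^ m ≠ 0) (n : ℕ) : qPoch ζ x n ≠ 0 := by
  refine Finset.prod_ne_zero_iff.2 fun j _ h => hx ?_
  have h' : ζ ^ (j + 1) * x = 1 := (sub_eq_zero.1 h).symm
  have : (ζ ^ (j + 1) * x) ^ m = 1 := by rw [h', one_pow]
  rw [mul_pow, ← pow_mul, mul_comm _ m, pow_mul, hζ, one_pow, one_mul] at this
  rw [this, sub_self]

lemma cyclicDilog_mul_left {L : Type*} [Field L] {ζ : L} {m : ℕ} (hm : 0 < m)
    (hζ : IsPrimitiveRoot ζ m) (x : L) :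
    cyclicDilog ζ m (ζ * x) * (1 - x ^ m) = cyclicDilog ζ m x * (1 - ζ * x) ^ m := by
  have h1 : (1 - x ^ m) = qPoch ζ (ζ * x) m := by
    rw [qPoch_order hm hζ, mul_pow, hζ.pow_eq_one, one_mul]
  have h2 := Finset.prod_range_succ (fun t => (1 - ζ ^ (t + 1) * x) ^ t) m
  rw [Finset.prod_range_succ'] at h2
  simp only [pow_zero, mul_one] at h2
  rw [h1, cyclicDilog, qPoch, ← Finset.prod_mul_distrib, cyclicDilog]
  rw [pow_succ ζ m, hζ.pow_eq_one, one_mul] at h2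
  rw [← h2]
  refine Finset.prod_congr rfl fun t _ => ?_
  ring

lemma cyclicDilog_pow_mul {L : Type*} [Field L] {ζ : L} {m : ℕ} (hm : 0 < m)
    (hζ : IsPrimitiveRoot ζ m) (x : L) (s : ℕ) :
    cyclicDilog ζ m (ζ ^ s * x) * (1 - x ^ m) ^ s = cyclicDilog ζ m x * qPoch ζ x s ^ m := by
  induction s with
  | zero => simp [qPoch]
  | succ s ih =>
    have h := cyclicDilog_mul_left hm hζ (ζ ^ s * x)
    rw [mul_pow _ x, ← pow_mul, mul_comm s m, pow_mul, hζ.pow_eq_one, one_pow, one_mul] at h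
    have h3 : qPoch ζ x (s + 1) = qPoch ζ x s * (1 - ζ * (ζ ^ s * x)) := by
      rw [qPoch, Finset.prod_range_succ, ← qPoch]; ring
    rw [h3, mul_pow, ← mul_assoc, ← ih, pow_succ' ζ, mul_assoc ζ, pow_succ' (1 - x ^ m), ← mul_assoc, h]
    ring

section

variable {ι : Type*} [Fintype ι]

/-- The summand of the Nahm sum at a root of unity, in terms of `η` with `η ^ d = ζ`. -/
def nahmTerm {L : Type*} [Field L] (d : ℕ) (M : Matrix ι ι ℤ) (q : (ι → ℕ) → ℤ)
    (η : L) (u : ι → L) (k : ι → ℕ) : L :=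
  η ^ q k * ∏ i, u i ^ (M.mulVec (fun j => (k j : ℤ)) i) / qPoch (η ^ d) (u i ^ d) (k i)

lemma nahmTerm_mul {L : Type*} [Field L] (d : ℕ) (M : Matrix ι ι ℤ) (q : (ι → ℕ) → ℤ)
    (hq : ∀ k s, q (k + s) = q k + q s + ∑ i, (s i : ℤ) * M.mulVec (fun j => (k j : ℤ)) i)
    {η : L} (hη : η ≠ 0) {u : ι → L} (hu : ∀ i, u i ≠ 0) (k s : ι → ℕ) :
    nahmTerm d M q η (fun i => η ^ s i * u i) k * nahmTerm d M q η u s =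
      nahmTerm d M q η u (k + s) := by
  unfold nahmTerm
  rw [mul_mul_mul_comm, ← Finset.prod_mul_distrib, hq, zpow_add₀ hη, zpow_add₀ hη]
  have hs : η ^ (∑ i, (s i : ℤ) * M.mulVec (fun j => (k j : ℤ)) i) =
      ∏ i, η ^ ((s i : ℤ) * M.mulVec (fun j => (k j : ℤ)) i) := by
    induction (Finset.univ : Finset ι) using Finset.cons_induction with
    | empty => simp
    | cons a t ha ih => rw [Finset.sum_cons, Finset.prod_cons, zpow_add₀ hη, ih]
  rw [hs, mul_assoc _ (∏ i, _), ← Finset.prod_mul_distrib]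
  congr 1
  refine Finset.prod_congr rfl fun i _ => ?_
  have h1 : M.mulVec (fun j => (((k + s) j : ℕ) : ℤ)) i =
      M.mulVec (fun j => (k j : ℤ)) i + M.mulVec (fun j => (s j : ℤ)) i := by
    rw [← Pi.add_apply, ← Matrix.mulVec_add]
    congr 2
  rw [h1, zpow_add₀ (hu i), Pi.add_apply, qPoch_add, mul_zpow, _root_.zpow_mul, zpow_natCast,
    mul_pow, ← pow_mul, mul_comm (s i) d, pow_mul]
  ring

lemma prod_zpow_mulVec {L : Type*} [Field L] {d m : ℕ} {M : Matrix ι ι ℤ} (hM : M.IsSymm)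
    {u : ι → L} (hu : ∀ i, u i ≠ 0)
    (hN : ∀ i, 1 - (u i ^ d) ^ m = ∏ j, (u j ^ m) ^ M i j) (s : ι → ℕ) :
    ∏ i, (u i ^ m) ^ (M.mulVec (fun j => (s j : ℤ)) i) = ∏ i, (1 - (u i ^ d) ^ m) ^ s i := by
  simp_rw [hN, ← Finset.prod_pow]
  rw [Finset.prod_comm]
  refine Finset.prod_congr rfl fun i _ => ?_
  have hs (f : ι → ℤ) : (u i ^ m) ^ (∑ j, f j) = ∏ j, (u i ^ m) ^ f j := by
    induction (Finset.univ : Finset ι) using Finset.cons_induction with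
    | empty => simp
    | cons a t ha ih => rw [Finset.sum_cons, Finset.prod_cons, zpow_add₀ (pow_ne_zero _ (hu i)), ih]
  rw [Matrix.mulVec, dotProduct, hs]
  refine Finset.prod_congr rfl fun j _ => ?_
  rw [_root_.zpow_mul, zpow_natCast, hM.apply]

lemma nahmTerm_order {L : Type*} [Field L] {d m : ℕ} (hm : 0 < m) {M : Matrix ι ι ℤ}
    (hM : M.IsSymm) {q : (ι → ℕ) → ℤ} (hqm : ∀ l, (m : ℤ) ∣ q (m • l))
    {η : L} (hη : η ^ m = 1) (hζ : IsPrimitiveRoot (η ^ d) m) {u : ι → L} (hu : ∀ i, u i ≠ 0)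
    (hN : ∀ i, 1 - (u i ^ d) ^ m = ∏ j, (u j ^ m) ^ M i j) (l : ι → ℕ) :
    nahmTerm d M q η u (m • l) = 1 := by
  unfold nahmTerm
  obtain ⟨c, hc⟩ := hqm l
  have hx (i) : 1 - (u i ^ d) ^ m ≠ 0 := by
    rw [hN]; exact Finset.prod_ne_zero_iff.2 fun j _ => zpow_ne_zero _ (pow_ne_zero _ (hu j))
  rw [hc, _root_.zpow_mul, zpow_natCast, hη, _root_.one_zpow, one_mul, Finset.prod_div_distrib]
  have h1 (i) : u i ^ (M.mulVec (fun j => (((m • l) j : ℕ) : ℤ)) i) =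
      (u i ^ m) ^ (M.mulVec (fun j => (l j : ℤ)) i) := by
    rw [← zpow_natCast, ← _root_.zpow_mul]
    congr 1
    simp only [Matrix.mulVec, dotProduct, Finset.mul_sum, Pi.smul_apply, smul_eq_mul, Nat.cast_mul]
    exact Finset.sum_congr rfl fun j _ => by ring
  simp_rw [h1, prod_zpow_mulVec hM hu hN, Pi.smul_apply, smul_eq_mul, qPoch_order_mul hm hζ]
  exact div_self (Finset.prod_ne_zero_iff.2 fun i _ => pow_ne_zero _ (hx i))


lemma nahmTerm_add_order {L : Type*} [Field L] {d m : ℕ} (hm : 0 < m) {M : Matrix ι ι ℤ}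
    (hM : M.IsSymm) {q : (ι → ℕ) → ℤ} (hqm : ∀ l, (m : ℤ) ∣ q (m • l))
    (hq : ∀ k s, q (k + s) = q k + q s + ∑ i, (s i : ℤ) * M.mulVec (fun j => (k j : ℤ)) i)
    {η : L} (hη : η ^ m = 1) (hζ : IsPrimitiveRoot (η ^ d) m) {u : ι → L} (hu : ∀ i, u i ≠ 0)
    (hN : ∀ i, 1 - (u i ^ d) ^ m = ∏ j, (u j ^ m) ^ M i j) (k l : ι → ℕ) :
    nahmTerm d M q η u (k + m • l) = nahmTerm d M q η u k := by
  have hη0 : η ≠ 0 := by rintro rfl; simp [hm.ne'] at hη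
  rw [← nahmTerm_mul d M q hq hη0 hu, nahmTerm_order hm hM hqm hη hζ hu hN, mul_one]
  simp [pow_mul, hη]

lemma nahmTerm_pow_order {L : Type*} [Field L] {d m : ℕ} {M : Matrix ι ι ℤ}
    (hM : M.IsSymm) {q : (ι → ℕ) → ℤ} {η : L} (hη : η ^ m = 1) {u : ι → L} (hu : ∀ i, u i ≠ 0)
    (hN : ∀ i, 1 - (u i ^ d) ^ m = ∏ j, (u j ^ m) ^ M i j) (s : ι → ℕ) :
    nahmTerm d M q η u s ^ m =
      ∏ i, (1 - (u i ^ d) ^ m) ^ s i / qPoch (η ^ d) (u i ^ d) (s i) ^ m := by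
  rw [nahmTerm, mul_pow, ← zpow_natCast (η ^ _), ← _root_.zpow_mul, mul_comm (q s),
    _root_.zpow_mul, zpow_natCast, hη, _root_.one_zpow, one_mul, ← Finset.prod_pow,
    Finset.prod_div_distrib, ← prod_zpow_mulVec hM hu hN, ← Finset.prod_div_distrib]
  refine Finset.prod_congr rfl fun i _ => ?_
  rw [div_pow, ← zpow_natCast (u i ^ _), ← _root_.zpow_mul, mul_comm _ (m : ℤ), _root_.zpow_mul,
    zpow_natCast]

lemma sum_add_of_periodic [DecidableEq ι] {L : Type*} [AddCommMonoid L] {m : ℕ} (hm : 0 < m)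
    {f : (ι → ℕ) → L} (hf : ∀ k l, f (k + m • l) = f k) (s : ι → ℕ) :
    ∑ k : ι → Fin m, f ((fun i => (k i : ℕ)) + s) = ∑ k : ι → Fin m, f fun i => (k i : ℕ) := by
  have : NeZero m := ⟨hm.ne'⟩
  rw [← Equiv.sum_comp (Equiv.addRight fun i => Fin.ofNat m (s i))
    (fun k : ι → Fin m => f fun i => (k i : ℕ))]
  refine Finset.sum_congr rfl fun k _ => ?_
  rw [← hf (fun i => ((Equiv.addRight fun i => Fin.ofNat m (s i)) k i : Fin m)) fun i => (k i + s i) / m]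
  congr 1
  ext i
  simp [Fin.val_add, Nat.mod_add_div]

/-- The `m`-th power of the normalised Nahm sum at a root of unity. -/
def nahmPow [DecidableEq ι] {L : Type*} [Field L] (d m : ℕ) (M : Matrix ι ι ℤ)
    (q : (ι → ℕ) → ℤ) (η : L) (u : ι → L) : L :=
  (∑ k : ι → Fin m, nahmTerm d M q η u fun i => (k i : ℕ)) ^ m /
    ∏ i, cyclicDilog (η ^ d) m (u i ^ d)

lemma map_nahmPow [DecidableEq ι] {L L' : Type*} [Field L] [Field L'] (d m : ℕ)
    (M : Matrix ι ι ℤ) (q : (ι → ℕ) → ℤ) (η : L) (u : ι → L) (φ : L →+* L') :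
    φ (nahmPow d m M q η u) = nahmPow d m M q (φ η) fun i => φ (u i) := by
  simp [nahmPow, nahmTerm, cyclicDilog, qPoch]

lemma nahmPow_mul [DecidableEq ι] {L : Type*} [Field L] {d m : ℕ} (hm : 0 < m)
    {M : Matrix ι ι ℤ} (hM : M.IsSymm) {q : (ι → ℕ) → ℤ} (hqm : ∀ l, (m : ℤ) ∣ q (m • l))
    (hq : ∀ k s, q (k + s) = q k + q s + ∑ i, (s i : ℤ) * M.mulVec (fun j => (k j : ℤ)) i)
    {η : L} (hη : η ^ m = 1) (hζ : IsPrimitiveRoot (η ^ d) m) {u : ι → L} (hu : ∀ i, u i ≠ 0)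
    (hN : ∀ i, 1 - (u i ^ d) ^ m = ∏ j, (u j ^ m) ^ M i j) (s : ι → ℕ) :
    nahmPow d m M q η (fun i => η ^ s i * u i) = nahmPow d m M q η u := by
  have hη0 : η ≠ 0 := by rintro rfl; simp [hm.ne'] at hη
  have hx (i) : 1 - (u i ^ d) ^ m ≠ 0 := by
    rw [hN]; exact Finset.prod_ne_zero_iff.2 fun j _ => zpow_ne_zero _ (pow_ne_zero _ (hu j))
  have hP (i) : qPoch (η ^ d) (u i ^ d) (s i) ≠ 0 := qPoch_ne_zero hζ.pow_eq_one (hx i) _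
  have hs := sum_add_of_periodic hm (nahmTerm_add_order hm hM hqm hq hη hζ hu hN) s
  simp_rw [← nahmTerm_mul d M q hq hη0 hu _ s, ← Finset.sum_mul] at hs
  have hD (i) : cyclicDilog (η ^ d) m (u i ^ d) = cyclicDilog (η ^ d) m ((η ^ s i * u i) ^ d) *
      ((1 - (u i ^ d) ^ m) ^ s i / qPoch (η ^ d) (u i ^ d) (s i) ^ m) := by
    have h := cyclicDilog_pow_mul hm hζ (u i ^ d) (s i)
    rw [mul_pow, ← pow_mul, mul_comm (s i), pow_mul, ← mul_div_assoc, h,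
      mul_div_cancel_right₀ _ (pow_ne_zero _ (hP i))]
  have hf : nahmTerm d M q η u s ^ m ≠ 0 := by
    rw [nahmTerm_pow_order hM hη hu hN]
    exact Finset.prod_ne_zero_iff.2 fun i _ =>
      div_ne_zero (pow_ne_zero _ (hx i)) (pow_ne_zero _ (hP i))
  rw [nahmPow, nahmPow, ← hs, Finset.prod_congr rfl fun i _ => hD i, Finset.prod_mul_distrib,
    ← nahmTerm_pow_order hM hη hu hN, mul_pow, mul_div_mul_right _ _ hf]

lemma nahmPow_mem [DecidableEq ι] {d m : ℕ} (hm : 0 < m)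
    {M : Matrix ι ι ℤ} (hM : M.IsSymm) {q : (ι → ℕ) → ℤ} (hqm : ∀ l, (m : ℤ) ∣ q (m • l))
    (hq : ∀ k s, q (k + s) = q k + q s + ∑ i, (s i : ℤ) * M.mulVec (fun j => (k j : ℤ)) i)
    (K : Subfield ℂ) {η : ℂ} (hη : IsPrimitiveRoot η m) (hζ : IsPrimitiveRoot (η ^ d) m)
    (hηK : η ∈ K) {u : ι → ℂ} (hu : ∀ i, u i ≠ 0) (huK : ∀ i, u i ^ m ∈ K)
    (hN : ∀ i, 1 - (u i ^ d) ^ m = ∏ j, (u j ^ m) ^ M i j) :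
    nahmPow d m M q η u ∈ K := by
  have : NeZero m := ⟨hm.ne'⟩
  let E := algebraicClosure K ℂ
  have hE (i) : u i ∈ E := by
    rw [mem_algebraicClosure_iff']
    refine IsIntegral.of_pow hm ?_
    exact isIntegral_algebraMap (x := (⟨u i ^ m, huK i⟩ : K))
  let v : ι → E := fun i => ⟨u i, hE i⟩
  let η' : E := algebraMap K E ⟨η, hηK⟩
  let φ : E →+* ℂ := algebraMap E ℂ
  have hφ : Function.Injective φ := φ.injective
  have hη' : IsPrimitiveRoot η' m := IsPrimitiveRoot.of_map_of_injective (f := φ) hη hφ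
  have hζ' : IsPrimitiveRoot (η' ^ d) m :=
    IsPrimitiveRoot.of_map_of_injective (f := φ) (by rw [map_pow]; exact hζ) hφ
  have hv (i) : v i ≠ 0 := fun h => hu i (congrArg φ h)
  have hNv (i) : 1 - (v i ^ d) ^ m = ∏ j, (v j ^ m) ^ M i j := by
    apply hφ
    simp only [map_sub, map_one, map_pow, map_prod, map_zpow₀]
    exact hN i
  have hmap : φ (nahmPow d m M q η' v) = nahmPow d m M q η u := map_nahmPow ..
  have hfix : ∀ σ : E ≃ₐ[K] E, σ (nahmPow d m M q η' v) = nahmPow d m M q η' v := by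
    intro σ
    have h1 (i) : ∃ s, η' ^ s * v i = σ (v i) := by
      have hw : v i ^ m = algebraMap K E ⟨u i ^ m, huK i⟩ := rfl
      obtain ⟨s, _, hs⟩ := hη'.eq_pow_of_pow_eq_one (ξ := σ (v i) / v i) (by
        rw [div_pow, ← map_pow, hw, σ.commutes, ← hw, div_self (pow_ne_zero _ (hv i))])
      exact ⟨s, by rw [hs, div_mul_cancel₀ _ (hv i)]⟩
    choose s hs using h1
    have h2 := map_nahmPow d m M q η' v (σ : E →+* E)
    simp only [RingHom.coe_coe, ← hs] at h2
    rw [h2, σ.commutes]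
    exact nahmPow_mul hm hM hqm hq hη'.pow_eq_one hζ' hv hNv s
  obtain ⟨y, hy⟩ := IntermediateField.mem_bot.1 ((InfiniteGalois.mem_bot_iff_fixed _).2 hfix)
  rw [← hmap, ← hy]
  exact y.2

end

theorem stmt_17 (N : ℕ) (hN : 0 < N)
    (A : Matrix (Fin N) (Fin N) ℚ) (hAsymm : A.IsSymm)
    (hApos : (A.map ((↑) : ℚ → ℝ)).PosDef)
    (B : Fin N → ℚ)
    (Q : (Fin N → ℤ) → ℚ)
    (hQ : ∀ n, Q n = (1 / 2) * ((fun i => (n i : ℚ)) ⬝ᵥ A.mulVec fun i => (n i : ℚ)) +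
      B ⬝ᵥ fun i => (n i : ℚ))
    (d : ℕ) (hd : 0 < d) (hdQ : ∀ k, ∃ t : ℤ, (d : ℚ) * Q k = t)
    (m : ℕ) (hmodd : Odd m) (hm : 0 < m) (hmd : Nat.Coprime m (2 * d))
    (a : ℤ) (ha : Int.gcd a m = 1)
    (ζ : ℂ) (hζ : ζ = Complex.exp (2 * (Real.pi : ℂ) * I * a / m))
    (z : Fin N → ℝ) (hz : ∀ i, z i ∈ Set.Ioo (0 : ℝ) 1)
    (hNahm : ∀ i, 1 - z i = ∏ j, z j ^ ((A i j : ℝ)))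
    (θ : Fin N → ℝ) (hθ : ∀ i, θ i = z i ^ ((m : ℝ))⁻¹)
    (r : (Fin N → Fin m) → ℤ)
    (hr : ∀ k : Fin N → Fin m, ∃ t : ℤ,
      (d : ℚ) * Q (fun i => ((k i : ℕ) : ℤ)) = t ∧ (m : ℤ) ∣ (d : ℤ) * r k - t)
    (S : ℂ)
    (hS : S = (∏ i, Complex.exp (-(1 / (m : ℂ)) *
        ∑ t ∈ Finset.Icc 1 (m - 1), (t : ℂ) * Complex.log (1 - ζ ^ (t + 1) * (θ i : ℂ)))) *
      ∑ k : Fin N → Fin m, Complex.exp (2 * (Real.pi : ℂ) * I * a * r k / m) *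
        ∏ i, ((θ i ^ (((A.mulVec fun j => ((k j : ℕ) : ℚ)) i : ℝ)) : ℝ) : ℂ) /
          ∏ j ∈ Finset.Icc 1 (k i : ℕ), (1 - ζ ^ j * (θ i : ℂ))) :
    S ^ m ∈ Subfield.closure
      ({ζ} ∪ Set.range fun i : Fin N => ((z i ^ ((d : ℝ))⁻¹ : ℝ) : ℂ)) := by
  have hz0 i : 0 < z i := (hz i).1
  have hmR : (m : ℝ) ≠ 0 := by exact_mod_cast hm.ne'
  have hdR : (d : ℝ) ≠ 0 := by exact_mod_cast hd.ne'
  have hQadd (x y : Fin N → ℤ) : Q (x + y) = Q x + Q y +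
      (fun i => (y i : ℚ)) ⬝ᵥ A.mulVec (fun i => (x i : ℚ)) := by
    have hxy : (fun i => (((x + y) i : ℤ) : ℚ)) = (fun i => (x i : ℚ)) + fun i => (y i : ℚ) := by
      ext i; simp
    have hc : (fun i => (x i : ℚ)) ⬝ᵥ A.mulVec (fun i => (y i : ℚ)) =
        (fun i => (y i : ℚ)) ⬝ᵥ A.mulVec (fun i => (x i : ℚ)) := by
      rw [Matrix.dotProduct_mulVec, ← Matrix.mulVec_transpose, hAsymm.eq, dotProduct_comm]
    rw [hQ, hQ, hQ, hxy, Matrix.mulVec_add, add_dotProduct, dotProduct_add, dotProduct_add,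
      dotProduct_add, hc]
    ring
  choose q hq using hdQ
  have hMex (i j) : ∃ t : ℤ, (t : ℚ) = d * A i j := by
    refine ⟨q (Pi.single j 1 + Pi.single i 1) - q (Pi.single j 1) - q (Pi.single i 1), ?_⟩
    have hs (j : Fin N) : (fun l => ((Pi.single j 1 : Fin N → ℤ) l : ℚ)) = Pi.single j 1 := by
      ext l
      by_cases h : l = j
      · subst h; simp
      · simp [h]
    push_cast
    rw [← hq, ← hq, ← hq, hQadd, hs, hs]
    simp
    ring
  choose M hM using hMex
  let M' : Matrix (Fin N) (Fin N) ℤ := Matrix.of M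
  have hM' (i j) : ((M' i j : ℤ) : ℚ) = d * A i j := hM i j
  have hMsymm : M'.IsSymm := by
    ext i j
    rw [Matrix.transpose_apply]
    have : ((M' j i : ℤ) : ℚ) = M' i j := by rw [hM', hM', hAsymm.apply]
    exact_mod_cast this
  have hMvec (k : Fin N → ℕ) (i : Fin N) : ((M'.mulVec (fun j => (k j : ℤ)) i : ℤ) : ℚ) =
      d * A.mulVec (fun j => (k j : ℚ)) i := by
    simp only [Matrix.mulVec, dotProduct, Finset.mul_sum, Int.cast_sum, Int.cast_mul, hM',
      Int.cast_natCast, mul_assoc]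
  let q' : (Fin N → ℕ) → ℤ := fun k => q fun i => (k i : ℤ)
  have hq' (k s : Fin N → ℕ) : q' (k + s) =
      q' k + q' s + ∑ i, (s i : ℤ) * M'.mulVec (fun j => (k j : ℤ)) i := by
    have h := hQadd (fun i => (k i : ℤ)) (fun i => (s i : ℤ))
    have h' : ((q' (k + s) : ℤ) : ℚ) =
        ((q' k + q' s + ∑ i, (s i : ℤ) * M'.mulVec (fun j => (k j : ℤ)) i : ℤ) : ℚ) := by
      push_cast
      simp_rw [hMvec]
      simp only [q']
      rw [← hq, ← hq, ← hq]
      have e : (fun i => (((k + s) i : ℕ) : ℤ)) = (fun i => (k i : ℤ)) + fun i => (s i : ℤ) := by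
        ext i; simp
      rw [e, h]
      simp only [dotProduct, Int.cast_natCast, mul_add, Finset.mul_sum]
      congr 1
      exact Finset.sum_congr rfl fun i _ => by ring
    exact_mod_cast h'
  have hqm (l : Fin N → ℕ) : (m : ℤ) ∣ q' (m • l) := by
    have hmul (n : ℕ) : 2 * q' (n • l) = 2 * n * q' l +
        n * (n - 1) * ∑ i, (l i : ℤ) * M'.mulVec (fun j => (l j : ℤ)) i := by
      induction n with
      | zero =>
        have h0 := hq' 0 0
        have : q' 0 = 0 := by simpa using h0
        simp [this]
      | succ n ih =>
        have hv (i) : M'.mulVec (fun j => (((n • l) j : ℕ) : ℤ)) i =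
            n * M'.mulVec (fun j => (l j : ℤ)) i := by
          simp only [Matrix.mulVec, dotProduct, Finset.mul_sum, Pi.smul_apply, smul_eq_mul,
            Nat.cast_mul]
          exact Finset.sum_congr rfl fun j _ => by ring
        have hsum : ∑ i, (l i : ℤ) * (n * M'.mulVec (fun j => (l j : ℤ)) i) =
            n * ∑ i, (l i : ℤ) * M'.mulVec (fun j => (l j : ℤ)) i := by
          rw [Finset.mul_sum]
          exact Finset.sum_congr rfl fun j _ => by ring
        rw [succ_nsmul, hq']
        simp_rw [hv]
        rw [hsum, mul_add, mul_add, ih]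
        push_cast
        ring
    have h2 : (m : ℤ) ∣ 2 * q' (m • l) := by
      rw [hmul]
      exact ⟨2 * q' l + (m - 1) * ∑ i, (l i : ℤ) * M'.mulVec (fun j => (l j : ℤ)) i, by ring⟩
    have hcop : IsCoprime (m : ℤ) 2 := by
      have := Nat.isCoprime_iff_coprime.2 hmodd.coprime_two_right
      exact_mod_cast this
    exact hcop.dvd_of_dvd_mul_left h2
  have hζprim : IsPrimitiveRoot ζ m := by
    have := Complex.isPrimitiveRoot_exp_of_isCoprime a m hm.ne' (Int.isCoprime_iff_gcd_eq_one.2 ha)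
    rw [hζ]
    convert this using 2
    ring
  obtain ⟨e, c, hce⟩ : IsCoprime (m : ℤ) d :=
    Nat.isCoprime_iff_coprime.2 (Nat.Coprime.coprime_mul_left_right hmd)
  have hζ0 : ζ ≠ 0 := hζprim.ne_zero hm.ne'
  have hζzpow (t : ℤ) : ζ ^ ((m : ℤ) * t) = 1 := by
    rw [_root_.zpow_mul, zpow_natCast, hζprim.pow_eq_one, _root_.one_zpow]
  have hηd : (ζ ^ c) ^ d = ζ := by
    rw [← zpow_natCast, ← _root_.zpow_mul]
    have : c * (d : ℤ) = 1 + m * (-e) := by linarith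
    rw [this, zpow_add₀ hζ0, hζzpow, zpow_one, mul_one]
  have hη : IsPrimitiveRoot (ζ ^ c) m := by
    refine hζprim.zpow_of_gcd_eq_one c ?_
    rw [← Int.isCoprime_iff_gcd_eq_one]
    exact ⟨d, e, by linarith⟩
  let u : Fin N → ℂ := fun i => ((z i ^ ((d : ℝ) * m)⁻¹ : ℝ) : ℂ)
  have hum (i) : u i ^ m = ((z i ^ ((d : ℝ))⁻¹ : ℝ) : ℂ) := by
    simp only [u]
    rw [← Complex.ofReal_pow, ← Real.rpow_natCast, ← Real.rpow_mul (hz0 i).le]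
    congr 2
    field_simp
  have hud (i) : u i ^ d = (θ i : ℂ) := by
    simp only [u]
    rw [← Complex.ofReal_pow, ← Real.rpow_natCast, ← Real.rpow_mul (hz0 i).le, hθ]
    congr 2
    field_simp
  have hθm (i) : θ i ^ m = z i := by
    rw [hθ, ← Real.rpow_natCast, ← Real.rpow_mul (hz0 i).le, inv_mul_cancel₀ hmR, Real.rpow_one]
  have hθ1 (i) : 0 < θ i ∧ θ i < 1 := by
    rw [hθ]
    exact ⟨Real.rpow_pos_of_pos (hz0 i) _,
      Real.rpow_lt_one (hz0 i).le (hz i).2 (by positivity)⟩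
  have hu (i) : u i ≠ 0 := Complex.ofReal_ne_zero.2 (Real.rpow_pos_of_pos (hz0 i) _).ne'
  have hN' (i) : 1 - (u i ^ d) ^ m = ∏ j, (u j ^ m) ^ M' i j := by
    rw [hud, ← Complex.ofReal_pow, hθm]
    have := congrArg (fun x : ℝ => (x : ℂ)) (hNahm i)
    simp only [Complex.ofReal_sub, Complex.ofReal_one, Complex.ofReal_prod] at this
    rw [this]
    refine Finset.prod_congr rfl fun j _ => ?_
    rw [hum, ← Complex.ofReal_zpow, ← Real.rpow_intCast, ← Real.rpow_mul (hz0 j).le]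
    congr 2
    have h : ((M' i j : ℤ) : ℝ) = d * (A i j : ℝ) := by
      exact_mod_cast congrArg (fun x : ℚ => (x : ℝ)) (hM' i j)
    rw [h]
    field_simp
  have hζK : ζ ∈ Subfield.closure
      ({ζ} ∪ Set.range fun i : Fin N => ((z i ^ ((d : ℝ))⁻¹ : ℝ) : ℂ)) :=
    Subfield.subset_closure (Or.inl rfl)
  have key := nahmPow_mem hm hMsymm hqm hq' (Subfield.closure
      ({ζ} ∪ Set.range fun i : Fin N => ((z i ^ ((d : ℝ))⁻¹ : ℝ) : ℂ))) hη (hηd.symm ▸ hζprim)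
    (zpow_mem hζK c) hu
    (fun i => hum i ▸ Subfield.subset_closure (Or.inr ⟨i, rfl⟩)) hN'
  convert key using 1
  rw [hS, mul_pow, nahmPow, mul_comm, div_eq_mul_inv (_ ^ m)]
  congr 1
  · congr 1
    refine Finset.sum_congr rfl fun k _ => ?_
    rw [nahmTerm]
    congr 1
    · obtain ⟨t, ht, w, hw⟩ := hr k
      have hqt : q' (fun i => (k i : ℕ)) = t := by
        have : ((q' (fun i => (k i : ℕ)) : ℤ) : ℚ) = t := by rw [← ht, hq]
        exact_mod_cast this
      have h1 : (ζ ^ c) ^ q' (fun i => (k i : ℕ)) = ζ ^ r k := by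
        have : q' (fun i => (k i : ℕ)) = d * r k + m * (-w) := by rw [hqt]; linarith
        rw [this, zpow_add₀ (zpow_ne_zero _ hζ0), _root_.zpow_mul, zpow_natCast, hηd,
          _root_.zpow_mul, zpow_natCast, hη.pow_eq_one, _root_.one_zpow, mul_one]
      rw [h1, hζ, ← Complex.exp_int_mul]
      congr 1
      ring
    · refine Finset.prod_congr rfl fun i _ => ?_
      congr 1
      · rw [← Complex.ofReal_zpow, ← Real.rpow_intCast, hθ, ← Real.rpow_mul (hz0 i).le,
          ← Real.rpow_mul (hz0 i).le]
        congr 2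
        have h : ((M'.mulVec (fun j => ((k j : ℕ) : ℤ)) i : ℤ) : ℝ) =
            d * ((A.mulVec (fun j => ((k j : ℕ) : ℚ)) i : ℚ) : ℝ) := by
          exact_mod_cast congrArg (fun x : ℚ => (x : ℝ)) (hMvec (fun j => (k j : ℕ)) i)
        rw [h]
        field_simp
      · rw [qPoch, hηd, hud, Finset.range_eq_Ico,
          Finset.prod_Ico_add' (fun j => 1 - ζ ^ j * (θ i : ℂ)) 0 (k i : ℕ) 1]
        rfl
  · rw [← Finset.prod_pow, ← Finset.prod_inv_distrib]
    refine Finset.prod_congr rfl fun i _ => ?_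
    have hmC : (m : ℂ) ≠ 0 := by exact_mod_cast hm.ne'
    rw [← Complex.exp_nat_mul, ← mul_assoc, mul_neg, mul_one_div_cancel hmC, neg_one_mul,
      Complex.exp_neg, Complex.exp_sum, hηd, hud, cyclicDilog, Finset.range_eq_Ico,
      Finset.prod_eq_prod_Ico_succ_bot hm, pow_zero, one_mul]
    congr 1
    have hI : Finset.Icc 1 (m - 1) = Finset.Ico (0 + 1) m := by
      ext t; simp only [Finset.mem_Icc, Finset.mem_Ico]; omega
    rw [hI]
    refine Finset.prod_congr rfl fun t _ => ?_
    rw [Complex.exp_nat_mul, Complex.exp_log]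
    intro h
    have h1 : ζ ^ (t + 1) * (θ i : ℂ) = 1 := (sub_eq_zero.1 h).symm
    have h2 := congrArg norm h1
    rw [norm_mul, norm_pow, hζprim.norm'_eq_one hm.ne', one_pow, one_mul, Complex.norm_real,
      Real.norm_of_nonneg (hθ1 i).1.le, norm_one] at h2
    exact (hθ1 i).2.ne h2
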